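/- Lower bound on the leading-order forward-backward asymmetry: let H and L be Hermitian d×d complex matrices, set K := H − (i/2)·L, and let p : Fin d → ℝ satisfy p(n) > 0 for all n and Σ_n p(n) = 1; set ρ := diagonal(p). Assume every entry K_{m n} is nonzero. Then Σ_{m,n} p(n)·‖K_{m n}‖²·log(‖K_{m n}‖²/‖K_{n m}‖²) + Re(i·tr(ρ·(H·L − L·H))) ≥ (8/9)·[Re(i·tr(ρ·(H·L − L·H)))]² / Re(tr(ρ·(2·H² + (1/2)·L²))). -/

import Mathlib

open Matrix
open scoped BigOperators

theorem hasDerivAt_log_sub_rational {t : ℝ} (ht : 0 < t) :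
    HasDerivAt (fun t : ℝ => Real.log t - 17 / 9 + 1 / 9 * t⁻¹ + 32 / 9 * (t + 1)⁻¹)
      ((t - 1) * (3 * t - 1) ^ 2 / (9 * t ^ 2 * (t + 1) ^ 2)) t := by
  have h1 : t + 1 ≠ 0 := by positivity
  have h := (((Real.hasDerivAt_log ht.ne').sub_const (17 / 9)).add
    ((hasDerivAt_inv ht.ne').const_mul (1 / 9))).add
    ((((hasDerivAt_id t).add_const 1).fun_inv h1).const_mul (32 / 9))
  refine h.congr_deriv ?_
  simp only [id]
  field_simp
  ring

/-- The right side minus the left side has derivative `(t - 1) (3 t - 1)² / (9 t² (t + 1)²)`, so it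
is smallest at `t = 1`, where it vanishes. -/
theorem rational_le_log {t : ℝ} (ht : 0 < t) :
    17 / 9 - 1 / 9 * t⁻¹ - 32 / 9 * (t + 1)⁻¹ ≤ Real.log t := by
  set f : ℝ → ℝ := fun t => Real.log t - 17 / 9 + 1 / 9 * t⁻¹ + 32 / 9 * (t + 1)⁻¹ with hf
  have f_one : f 1 = 0 := by norm_num [hf]
  suffices h : f 1 ≤ f t by
    rw [f_one] at h
    simp only [hf] at h
    linarith
  rcases le_total t 1 with h1 | h1
  · refine antitoneOn_of_hasDerivWithinAt_nonpos (convex_Icc t 1)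
      (fun x hx => (hasDerivAt_log_sub_rational (ht.trans_le hx.1)).continuousAt.continuousWithinAt)
      (fun x hx => (hasDerivAt_log_sub_rational
        (ht.trans_le (interior_subset hx).1)).hasDerivWithinAt)
      (fun x hx => ?_) (Set.left_mem_Icc.2 h1) (Set.right_mem_Icc.2 h1) h1
    exact div_nonpos_of_nonpos_of_nonneg
      (mul_nonpos_of_nonpos_of_nonneg (sub_nonpos.2 (interior_subset hx).2) (sq_nonneg _))
      (by positivity)
  · refine monotoneOn_of_hasDerivWithinAt_nonneg (convex_Icc 1 t)
      (fun x hx => (hasDerivAt_log_sub_rational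
        (one_pos.trans_le hx.1)).continuousAt.continuousWithinAt)
      (fun x hx => (hasDerivAt_log_sub_rational
        (one_pos.trans_le (interior_subset hx).1)).hasDerivWithinAt)
      (fun x hx => ?_) (Set.left_mem_Icc.2 h1) (Set.right_mem_Icc.2 h1) h1
    exact div_nonneg (mul_nonneg (sub_nonneg.2 (interior_subset hx).1) (sq_nonneg _))
      (by positivity)

theorem sq_sub_div_add_le_mul_log_div {x y : ℝ} (hx : 0 < x) (hy : 0 < y) :
    8 / 9 * ((x - y) ^ 2 / (x + y)) ≤ x * Real.log (x / y) - (x - y) := by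
  have h := mul_le_mul_of_nonneg_left (rational_le_log (div_pos hx hy)) hx.le
  have e : x * (17 / 9 - 1 / 9 * (x / y)⁻¹ - 32 / 9 * (x / y + 1)⁻¹) =
      8 / 9 * ((x - y) ^ 2 / (x + y)) + (x - y) := by
    field_simp
    ring
  linarith

/-- A second-order refinement of the log-sum inequality. -/
theorem sq_sum_sub_div_sum_add_le_sum_mul_log_div {ι : Type*} (s : Finset ι) {x y : ι → ℝ}
    (hx : ∀ i ∈ s, 0 < x i) (hy : ∀ i ∈ s, 0 < y i) :
    8 / 9 * ((∑ i ∈ s, (x i - y i)) ^ 2 / ∑ i ∈ s, (x i + y i)) ≤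
      ∑ i ∈ s, x i * Real.log (x i / y i) - ∑ i ∈ s, (x i - y i) := by
  calc _ ≤ 8 / 9 * ∑ i ∈ s, (x i - y i) ^ 2 / (x i + y i) := by
        gcongr
        exact Finset.sq_sum_div_le_sum_sq_div s _ fun i hi => add_pos (hx i hi) (hy i hi)
    _ ≤ ∑ i ∈ s, (x i * Real.log (x i / y i) - (x i - y i)) := by
        rw [Finset.mul_sum]
        exact Finset.sum_le_sum fun i hi => sq_sub_div_add_le_mul_log_div (hx i hi) (hy i hi)
    _ = _ := Finset.sum_sub_distrib ..

section EffectiveHamiltonian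

variable {n : Type*} [Fintype n] [DecidableEq n] {H L : Matrix n n ℂ}

theorem re_I_mul_trace_diagonal_mul_commutator (hH : H.IsHermitian) (hL : L.IsHermitian)
    (p : n → ℝ) :
    (Complex.I * (diagonal (fun j => (p j : ℂ)) * (H * L - L * H)).trace).re =
      -∑ i, ∑ j, (p j * ‖(H - (Complex.I / 2) • L) i j‖ ^ 2 -
        p j * ‖(H - (Complex.I / 2) • L) j i‖ ^ 2) := by
  rw [Finset.sum_comm, ← Finset.sum_neg_distrib]
  simp only [trace, diag_apply, diagonal_mul, Finset.mul_sum, Complex.re_sum]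
  refine Finset.sum_congr rfl fun j _ => ?_
  simp only [Matrix.sub_apply, mul_apply, ← Finset.sum_sub_distrib, Finset.mul_sum, Complex.re_sum,
    ← Finset.sum_neg_distrib]
  refine Finset.sum_congr rfl fun i _ => ?_
  simp only [Matrix.smul_apply, ← hH.apply j i, ← hL.apply j i,
    ← Complex.normSq_eq_norm_sq, Complex.normSq_apply]
  simp
  ring

theorem re_trace_diagonal_mul_sq_add_sq (hH : H.IsHermitian) (hL : L.IsHermitian)
    (p : n → ℝ) :
    (diagonal (fun j => (p j : ℂ)) * ((2 : ℂ) • H ^ 2 + ((1 : ℂ) / 2) • L ^ 2)).trace.re =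
      ∑ i, ∑ j, (p j * ‖(H - (Complex.I / 2) • L) i j‖ ^ 2 +
        p j * ‖(H - (Complex.I / 2) • L) j i‖ ^ 2) := by
  rw [Finset.sum_comm]
  simp only [trace, diag_apply, diagonal_mul, Complex.re_sum]
  refine Finset.sum_congr rfl fun j _ => ?_
  simp only [Matrix.add_apply, Matrix.smul_apply, pow_two H, pow_two L, mul_apply, Finset.smul_sum,
    ← Finset.sum_add_distrib, Finset.mul_sum, Complex.re_sum]
  refine Finset.sum_congr rfl fun i _ => ?_
  simp only [Matrix.sub_apply, Matrix.smul_apply, ← hH.apply j i, ← hL.apply j i,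
    ← Complex.normSq_eq_norm_sq, Complex.normSq_apply]
  simp
  ring

end EffectiveHamiltonian

/-- Lower bound on the leading-order forward-backward asymmetry: with
`K = H - (i/2) L` the effective Hamiltonian (`H`, `L` Hermitian), `ρ = diagonal p` a
diagonal density matrix with strictly positive eigenvalues, and all entries of `K`
nonzero,
`∑ m n, p n ‖K m n‖² log (‖K m n‖² / ‖K n m‖²) + Re (i tr (ρ [H, L]))`
is at least `(8/9) [Re (i tr (ρ [H, L]))]² / Re (tr (ρ (2 H² + L²/2)))`. -/
theorem asymmetry_leading_order_lower_bound (d : ℕ)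
    (H L : Matrix (Fin d) (Fin d) ℂ)
    (hH : H.IsHermitian) (hL : L.IsHermitian)
    (p : Fin d → ℝ) (hp : ∀ n, 0 < p n) (hpsum : ∑ n, p n = 1)
    (K : Matrix (Fin d) (Fin d) ℂ) (hK : K = H - (Complex.I / 2) • L)
    (ρ : Matrix (Fin d) (Fin d) ℂ) (hρ : ρ = Matrix.diagonal (fun n => (p n : ℂ)))
    (hKne : ∀ m n, K m n ≠ 0) :
    (∑ m, ∑ n, p n * ‖K m n‖ ^ 2 * Real.log (‖K m n‖ ^ 2 / ‖K n m‖ ^ 2)) +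
        (Complex.I * (ρ * (H * L - L * H)).trace).re ≥
      (8 / 9) * ((Complex.I * (ρ * (H * L - L * H)).trace).re) ^ 2 /
        ((ρ * ((2 : ℂ) • H ^ 2 + ((1 : ℂ) / 2) • L ^ 2)).trace).re := by
  subst hK hρ
  set K := H - (Complex.I / 2) • L with hK
  have hpos : ∀ m n, ∀ k, 0 < p k * ‖K m n‖ ^ 2 := fun m n k =>
    mul_pos (hp k) (pow_pos (norm_pos_iff.2 (hKne m n)) 2)
  have key := sq_sum_sub_div_sum_add_le_sum_mul_log_div Finset.univ
    (x := fun q : Fin d × Fin d => p q.2 * ‖K q.1 q.2‖ ^ 2)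
    (y := fun q => p q.2 * ‖K q.2 q.1‖ ^ 2)
    (fun q _ => hpos _ _ _) (fun q _ => hpos _ _ _)
  simp only [Fintype.sum_prod_type, mul_div_mul_left _ _ (hp _).ne'] at key
  rw [re_I_mul_trace_diagonal_mul_commutator hH hL, re_trace_diagonal_mul_sq_add_sq hH hL, ← hK,
    neg_sq, mul_div_assoc, ← sub_eq_add_neg]
  exact key
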